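/- Let I ⊆ M_n be a decreasing set of monomials. The code C(I)^⊥ = C(M_n \ Ī) is triply-even if and only if (M_n \ Ī)·(M_n \ Ī) ∩ (M_n \ I) = ∅, where Ī = {ᾱ : α ∈ I} and the product of two sets of monomials is the set of pairwise products. -/

import Mathlib

/-- The evaluation vector of the monomial with support `S ⊆ {0,…,n−1}`. -/
def ev {n : ℕ} (S : Finset (Fin n)) : (Fin n → ZMod 2) → ZMod 2 :=
  fun u => ∏ i ∈ S, u i

/-- Same-degree comparison of monomials via their sorted supports. -/
def sameDegLE {n : ℕ} (S T : Finset (Fin n)) : Prop :=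
  List.Forall₂ (· ≤ ·) (S.sort (· ≤ ·)) (T.sort (· ≤ ·))

/-- The strong order on monomials (identified with their supports). -/
def strongLE {n : ℕ} (S T : Finset (Fin n)) : Prop :=
  (S.card = T.card ∧ sameDegLE S T) ∨
  (S.card < T.card ∧ ∃ T' : Finset (Fin n), T'.card = S.card ∧ sameDegLE S T' ∧ T' ⊆ T)

/-- A set of monomials `I` is decreasing iff `g ∈ I` and `f ≼ g` imply `f ∈ I`. -/
def Decreasing {n : ℕ} (I : Set (Finset (Fin n))) : Prop :=
  ∀ ⦃f g : Finset (Fin n)⦄, g ∈ I → strongLE f g → f ∈ I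

/-- The monomial code `C(I)`: the `F_2`-span of the evaluation vectors of `I`. -/
def monomialCode {n : ℕ} (I : Set (Finset (Fin n))) :
    Submodule (ZMod 2) ((Fin n → ZMod 2) → ZMod 2) :=
  Submodule.span (ZMod 2) (ev '' I)

/-- A subspace `V ⊆ F_2^N` (coordinates indexed by a finite type `ι`) is
triply-even iff for all `u, v, w ∈ V` the number of coordinates where `u`, `v`,
`w` are all `1` is even. -/
def TriplyEven {ι : Type*} [Fintype ι] [DecidableEq ι]
    (V : Submodule (ZMod 2) (ι → ZMod 2)) : Prop :=
  ∀ u ∈ V, ∀ v ∈ V, ∀ w ∈ V,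
    Even (Finset.univ.filter (fun i : ι => u i = 1 ∧ v i = 1 ∧ w i = 1)).card

theorem strongLE_of_subset {n : ℕ} {S T : Finset (Fin n)} (h : S ⊆ T) : strongLE S T := by
  have hrefl : sameDegLE S S := List.forall₂_same.2 fun _ _ => le_rfl
  rcases (Finset.card_le_card h).lt_or_eq with hlt | heq
  · exact Or.inr ⟨hlt, S, rfl, hrefl, h⟩
  · obtain rfl := Finset.eq_of_subset_of_card_le h heq.ge
    exact Or.inl ⟨rfl, hrefl⟩

theorem Decreasing.mem_of_subset {n : ℕ} {I : Set (Finset (Fin n))} (hI : Decreasing I)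
    {S T : Finset (Fin n)} (hT : T ∈ I) (h : S ⊆ T) : S ∈ I :=
  hI hT (strongLE_of_subset h)

theorem ev_mul_ev {n : ℕ} (S T : Finset (Fin n)) : ev S * ev T = ev (S ∪ T) := by
  have hidem : ∀ a : ZMod 2, a * a = a := by decide
  have key (R : Finset (Fin n)) (u : Fin n → ZMod 2) :
      ev R u = ∏ i, if i ∈ R then u i else 1 := by
    simp [ev, Finset.prod_ite_mem]
  ext u
  rw [Pi.mul_apply, key, key, key, ← Finset.prod_mul_distrib]
  refine Finset.prod_congr rfl fun i _ => ?_
  by_cases hS : i ∈ S <;> by_cases hT : i ∈ T <;> simp [hS, hT, hidem]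

/-- A monomial sums to `1` over `F_2^n` exactly when it involves every variable. -/
theorem sum_ev {n : ℕ} (S : Finset (Fin n)) :
    ∑ u, ev S u = if S = Finset.univ then 1 else 0 := by
  have key (i : Fin n) :
      (∑ a : ZMod 2, if i ∈ S then a else 1) = if i ∈ S then 1 else 0 := by
    split_ifs <;> decide
  have hprod : ∑ u, ev S u = ∏ i, ∑ a : ZMod 2, if i ∈ S then a else 1 := by
    rw [Finset.prod_univ_sum, Fintype.piFinset_univ]
    refine Finset.sum_congr rfl fun u _ => ?_
    simp [ev, Finset.prod_ite_mem]
  rw [hprod]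
  simp_rw [key]
  rw [Finset.prod_ite_zero]
  simp [Finset.eq_univ_iff_forall]

theorem even_card_filter_iff {ι : Type*} [Fintype ι] (u v w : ι → ZMod 2) :
    Even (Finset.univ.filter (fun i : ι => u i = 1 ∧ v i = 1 ∧ w i = 1)).card ↔
      ∑ i, (u * v * w) i = 0 := by
  have h : ∀ a b c : ZMod 2, a * b * c = if a = 1 ∧ b = 1 ∧ c = 1 then 1 else 0 := by decide
  rw [← ZMod.natCast_eq_zero_iff_even]
  simp [h]

theorem sum_mul_eq_zero_of_mem_span {ι R : Type*} [Fintype ι] [CommSemiring R]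
    {s : Set (ι → R)} {y : ι → R} (h : ∀ x ∈ s, ∑ i, (x * y) i = 0)
    {x : ι → R} (hx : x ∈ Submodule.span R s) : ∑ i, (x * y) i = 0 := by
  induction hx using Submodule.span_induction with
  | mem x hx => exact h x hx
  | zero => simp
  | add a b _ _ ha hb => rw [add_mul]; simp only [Pi.add_apply, Finset.sum_add_distrib, ha, hb,
      add_zero]
  | smul c a _ ha => rw [smul_mul_assoc]; simp only [Pi.smul_apply, ← Finset.smul_sum, ha,
      smul_zero]

/-- A monomial code is triply-even iff no three of its monomials jointly involve all variables. -/
theorem triplyEven_monomialCode_iff {n : ℕ} (J : Set (Finset (Fin n))) :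
    TriplyEven (monomialCode J) ↔
      ∀ S ∈ J, ∀ T ∈ J, ∀ R ∈ J, S ∪ T ∪ R ≠ Finset.univ := by
  have hsum (S T R : Finset (Fin n)) :
      ∑ u, (ev S * ev T * ev R) u = 0 ↔ S ∪ T ∪ R ≠ Finset.univ := by
    rw [ev_mul_ev, ev_mul_ev, sum_ev]
    simp
  simp only [TriplyEven, even_card_filter_iff]
  constructor
  · intro h S hS T hT R hR
    have hmem {Q : Finset (Fin n)} (hQ : Q ∈ J) : ev Q ∈ monomialCode J :=
      Submodule.subset_span (Set.mem_image_of_mem ev hQ)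
    exact (hsum S T R).1 (h _ (hmem hS) _ (hmem hT) _ (hmem hR))
  · intro h u hu v hv w hw
    rw [mul_assoc]
    refine sum_mul_eq_zero_of_mem_span ?_ hu
    rintro _ ⟨S, hS, rfl⟩
    rw [mul_left_comm]
    refine sum_mul_eq_zero_of_mem_span ?_ hv
    rintro _ ⟨T, hT, rfl⟩
    rw [← mul_assoc, mul_comm]
    refine sum_mul_eq_zero_of_mem_span ?_ hw
    rintro _ ⟨R, hR, rfl⟩
    rw [mul_comm, mul_comm (ev T)]
    exact (hsum S T R).2 (h S hS T hT R hR)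

/-- for a decreasing set `I ⊆ M_n`, the dual code
`C(I)^⊥ = C(M_n \ Ī)` is triply-even iff `(M_n \ Ī)·(M_n \ Ī) ∩ (M_n \ I) = ∅`,
where `Ī = {ᾱ : α ∈ I}` and the product of sets is the set of pairwise products. -/
theorem triplyEven_dual_iff_inter_empty (n : ℕ) (I : Set (Finset (Fin n)))
    (hI : Decreasing I) :
    TriplyEven (monomialCode (((fun S : Finset (Fin n) => Sᶜ) '' I)ᶜ)) ↔
      Set.image2 (· ∪ ·) (((fun S : Finset (Fin n) => Sᶜ) '' I)ᶜ)
        (((fun S : Finset (Fin n) => Sᶜ) '' I)ᶜ) ∩ Iᶜ = ∅ := by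
  have hmem (S : Finset (Fin n)) : S ∈ ((fun S : Finset (Fin n) => Sᶜ) '' I)ᶜ ↔ Sᶜ ∉ I := by
    simp [compl_eq_comm]
  rw [triplyEven_monomialCode_iff, Set.eq_empty_iff_forall_notMem]
  constructor
  · rintro h _ ⟨⟨S, hS, T, hT, rfl⟩, hST⟩
    refine h S hS T hT (S ∪ T)ᶜ ((hmem _).2 ?_) (Finset.union_compl _)
    rwa [compl_compl]
  · intro h S hS T hT R hR hunion
    refine h (S ∪ T) ⟨⟨S, hS, T, hT, rfl⟩, fun hST => (hmem R).1 hR ?_⟩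
    refine hI.mem_of_subset hST fun i hi => ?_
    have hi' : i ∈ S ∪ T ∪ R := hunion ▸ Finset.mem_univ i
    exact (Finset.mem_union.1 hi').resolve_right (Finset.mem_compl.1 hi)
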